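/- For every α ∈ (0, 1/2) and every real parameter b, there exist ε > 0 and a solution (H, A, Z) of the CSS system on (1 − ε, 1 + ε), real-analytic in ρ and depending analytically on b, with the expansions H(ρ) = b(ρ−1) + O((ρ−1)²), A(ρ) = 1 − 2α − 2α(1−2α)b²(ρ−1) + O((ρ−1)²), Z(ρ) = ρ + O((ρ−1)²) as ρ → 1. -/

import Mathlib

open Real Filter Set Topology Asymptotics

noncomputable section

section Implicit

variable {E : Type*} [NormedAddCommGroup E] [NormedSpace ℝ E] [CompleteSpace E]

open scoped ContDiff in
/-- Local solvability of `u = u₀ b + x • S (x, u)` near `x = 0`, with local uniqueness. -/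
theorem exists_local_solution {S : ℝ × E → E} (hS : ContDiff ℝ ω S) {u₀ : ℝ → E}
    (hu₀ : ContDiff ℝ ω u₀) (b : ℝ) :
    ∃ (ψ : ℝ × ℝ → E) (η δ : ℝ), 0 < η ∧ 0 < δ ∧ δ ≤ 1 ∧
      ∀ c x : ℝ, |c - b| < η → |x| < η →
        AnalyticAt ℝ ψ (c, x) ∧ ‖ψ (c, x) - u₀ b‖ < δ ∧
        ∀ U : E, ‖U - u₀ b‖ < δ → (U = u₀ c + x • S (x, U) ↔ ψ (c, x) = U) := by
  set f : (ℝ × ℝ) × E → E := fun v => v.2 - u₀ v.1.1 - v.1.2 • S (v.1.2, v.2) with hf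
  have hfc : ContDiff ℝ ω f := by
    rw [hf]; fun_prop
  set v : (ℝ × ℝ) × E := ((b, 0), u₀ b) with hv
  have hfv : f v = 0 := by simp [hf, hv]
  have cdf : ContDiffAt ℝ ω f v := hfc.contDiffAt
  have hfd : fderiv ℝ f v ∘L .inr ℝ (ℝ × ℝ) E = ContinuousLinearMap.id ℝ E := by
    have h1 : HasFDerivAt (f ∘ fun u : E => ((b, 0), u))
        (fderiv ℝ f v ∘L .inr ℝ (ℝ × ℝ) E) (u₀ b) :=
      HasFDerivAt.comp (u₀ b) (cdf.differentiableAt (by simp)).hasFDerivAt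
        (hasFDerivAt_prodMk_right _ _)
    have h2 : HasFDerivAt (f ∘ fun u : E => ((b, 0), u)) (ContinuousLinearMap.id ℝ E) (u₀ b) := by
      have : (f ∘ fun u : E => (((b, 0) : ℝ × ℝ), u)) = fun u => u - u₀ b := by
        ext u; simp [hf]
      rw [this]
      exact (hasFDerivAt_id _).sub_const _
    exact h1.unique h2
  have inv : (fderiv ℝ f v ∘L .inr ℝ (ℝ × ℝ) E).IsInvertible := by
    rw [hfd]; exact ⟨ContinuousLinearEquiv.refl ℝ E, rfl⟩
  have hn : (ω : WithTop ℕ∞) ≠ 0 := by simp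
  set ψ := cdf.implicitFunction hn inv with hψ
  have hψb : ψ (b, 0) = u₀ b := cdf.implicitFunction_apply_self hn inv
  have hψa : AnalyticAt ℝ ψ (b, 0) := (cdf.contDiffAt_implicitFunction hn inv).analyticAt
  obtain ⟨δ, hδ, hδu⟩ := Metric.eventually_nhds_iff.1
    (cdf.eventually_apply_eq_iff_implicitFunction hn inv)
  have hev : ∀ᶠ p in 𝓝 ((b, 0) : ℝ × ℝ),
      AnalyticAt ℝ ψ p ∧ ‖ψ p - u₀ b‖ < min δ 1 := by
    refine hψa.eventually_analyticAt.and ?_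
    have : Tendsto (fun p => ‖ψ p - u₀ b‖) (𝓝 (b, 0)) (𝓝 ‖ψ (b, 0) - u₀ b‖) :=
      (hψa.continuousAt.sub continuousAt_const).norm
    refine this.eventually_lt_const ?_
    simp [hψb, hδ]
  obtain ⟨η, hη, hηu⟩ := Metric.eventually_nhds_iff.1 hev
  refine ⟨ψ, min η δ, min δ 1, lt_min hη hδ, lt_min hδ one_pos, min_le_right _ _, ?_⟩
  intro c x hc hx
  have hd : dist ((c, x) : ℝ × ℝ) (b, 0) < min η δ := by
    rw [Prod.dist_eq]
    exact max_lt (by rwa [Real.dist_eq]) (by rwa [Real.dist_eq, sub_zero])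
  obtain ⟨h1, h2⟩ := hηu (hd.trans_le (min_le_left _ _))
  refine ⟨h1, h2, fun U hU => ?_⟩
  have := hδu (y := ((c, x), U)) (by
    rw [Prod.dist_eq]
    exact max_lt (hd.trans_le (min_le_right _ _))
      (by rw [dist_eq_norm]; exact hU.trans_le (min_le_left _ _)))
  rw [hfv] at this
  rw [← this, hf]
  simp only [sub_sub, sub_eq_zero]

open scoped ContDiff in
/-- Gluing of the local solutions of `u = u₀ b + x • S (x, u)`. -/
theorem exists_glued_solution {S : ℝ × E → E} (hS : ContDiff ℝ ω S) {u₀ : ℝ → E}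
    (hu₀ : ContDiff ℝ ω u₀) :
    ∃ (Ψ : ℝ × ℝ → E) (η δ : ℝ → ℝ), ∀ b : ℝ, 0 < η b ∧ δ b ≤ 1 ∧
      ∀ x : ℝ, |x| < η b →
        AnalyticAt ℝ Ψ (b, x) ∧ ‖Ψ (b, x) - u₀ b‖ < δ b ∧
        Ψ (b, x) = u₀ b + x • S (x, Ψ (b, x)) ∧
        ∀ U : E, ‖U - u₀ b‖ < δ b → U = u₀ b + x • S (x, U) → Ψ (b, x) = U := by
  classical
  choose ψ η δ hη hδ hδ1 h using exists_local_solution hS hu₀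
  have hsol : ∀ a c x, |c - a| < η a → |x| < η a →
      ψ a (c, x) = u₀ c + x • S (x, ψ a (c, x)) := fun a c x hc hx =>
    ((h a c x hc hx).2.2 _ (h a c x hc hx).2.1).2 rfl
  have hzero : ∀ a c, |c - a| < η a → ψ a (c, 0) = u₀ c := fun a c hc => by
    simpa using hsol a c 0 hc (by simpa using hη a)
  have hcoh : ∀ a a' c x, |c - a| < η a → |x| < η a → |c - a'| < η a' → |x| < η a' →
      ψ a (c, x) = ψ a' (c, x) := by
    intro a a' c x hc hx hc' hx'
    have han : ∀ a, |c - a| < η a → ∀ r, |r| < η a →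
        AnalyticAt ℝ (fun y => ψ a (c, y)) r := fun a hc r hr =>
      AnalyticAt.fun_comp (f := fun y : ℝ => (c, y)) (h a c r hc hr).1
        (analyticAt_const.prod analyticAt_id)
    set m := min (η a) (η a')
    have hm : 0 < m := lt_min (hη a) (hη a')
    have key : EqOn (fun y => ψ a (c, y)) (fun y => ψ a' (c, y)) (Ioo (-m) m) := by
      refine AnalyticOnNhd.eqOn_of_preconnected_of_eventuallyEq (𝕜 := ℝ) (z₀ := 0)
        (fun r hr => han a hc r ((abs_lt.2 hr).trans_le (min_le_left _ _)))
        (fun r hr => han a' hc' r ((abs_lt.2 hr).trans_le (min_le_right _ _)))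
        isPreconnected_Ioo ⟨by linarith, hm⟩ ?_
      have hcont := (han a hc 0 (by simpa using hη a)).continuousAt
      have ht : Tendsto (fun y => ‖ψ a (c, y) - u₀ a'‖) (𝓝 0) (𝓝 ‖ψ a (c, 0) - u₀ a'‖) :=
        (hcont.sub continuousAt_const).norm
      have hlt : ‖ψ a (c, 0) - u₀ a'‖ < δ a' := by
        rw [hzero a c hc, ← hzero a' c hc']
        exact (h a' c 0 hc' (by simpa using hη a')).2.1
      filter_upwards [ht.eventually_lt_const hlt, Ioo_mem_nhds (neg_lt_zero.2 hm) hm] with y hy hym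
      have hym' := abs_lt.2 hym
      exact (((h a' c y hc' (hym'.trans_le (min_le_right _ _))).2.2 _ hy).1
        (hsol a c y hc (hym'.trans_le (min_le_left _ _)))).symm
    exact key (abs_lt.1 (lt_min hx hx'))
  set Ψ : ℝ × ℝ → E := fun p =>
    if hp : ∃ a, |p.1 - a| < η a ∧ |p.2| < η a then ψ hp.choose p else 0 with hΨ
  have hΨeq : ∀ a c x, |c - a| < η a → |x| < η a → Ψ (c, x) = ψ a (c, x) := by
    intro a c x hc hx
    have hp : ∃ a, |c - a| < η a ∧ |x| < η a := ⟨a, hc, hx⟩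
    simp only [hΨ]
    rw [dif_pos hp]
    exact hcoh _ _ _ _ hp.choose_spec.1 hp.choose_spec.2 hc hx
  refine ⟨Ψ, η, δ, fun b => ⟨hη b, hδ1 b, fun x hx => ?_⟩⟩
  have hb : |b - b| < η b := by simpa using hη b
  rw [hΨeq b b x hb hx]
  refine ⟨?_, (h b b x hb hx).2.1, hsol b b x hb hx,
    fun U hU hUe => ((h b b x hb hx).2.2 U hU).1 hUe⟩
  refine (h b b x hb hx).1.congr ?_
  have hopen : {p : ℝ × ℝ | |p.1 - b| < η b ∧ |p.2| < η b} ∈ 𝓝 (b, x) := by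
    refine IsOpen.mem_nhds ?_ ⟨hb, hx⟩
    have h1 : Continuous fun p : ℝ × ℝ => |p.1 - b| := by fun_prop
    have h2 : Continuous fun p : ℝ × ℝ => |p.2| := by fun_prop
    exact (isOpen_lt h1 continuous_const).inter (isOpen_lt h2 continuous_const)
  filter_upwards [hopen] with p hp
  exact (hΨeq b p.1 p.2 hp.1 hp.2).symm

end Implicit

section Averaging

open scoped unitInterval
open MeasureTheory

/-- The averaging operator `f ↦ (t ↦ ∫₀¹ f (s t) ds)` on `C([0,1], ℝ)`. -/
def avg : C(I, ℝ) →L[ℝ] C(I, ℝ) :=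
  LinearMap.mkContinuous
    { toFun := fun f => ⟨fun t => ∫ s : I, f (s * t), by
        have := continuous_parametric_integral_of_continuous (μ := (volume : Measure I))
          (f := fun (t : I) (s : I) => f (s * t)) (by
            simp only [Function.uncurry_def]; fun_prop) isCompact_univ
        simpa using this⟩
      map_add' := fun f g => by
        ext t
        exact integral_add
          (Continuous.integrable_of_hasCompactSupport (by fun_prop)
            (HasCompactSupport.of_compactSpace _))
          (Continuous.integrable_of_hasCompactSupport (by fun_prop)
            (HasCompactSupport.of_compactSpace _))
      map_smul' := fun r f => by
        ext t
        exact integral_const_mul r _ } 1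
    fun f => by
      rw [one_mul, ContinuousMap.norm_le _ (norm_nonneg f)]
      intro t
      have := norm_integral_le_of_norm_le_const (μ := (volume : Measure I))
        (f := fun s : I => f (s * t)) (C := ‖f‖) (ae_of_all _ fun s => f.norm_coe_le_norm _)
      simpa using this

theorem avg_apply (f : C(I, ℝ)) (t : I) : avg f t = ∫ s : I, f (s * t) := rfl

theorem avg_one : avg 1 = 1 := by
  ext t; simp [avg_apply]

/-- Dilation `f ↦ (s ↦ f (t s))` on `C([0,1], ℝ)`. -/
def dil (t : I) : C(I, ℝ) →ₐ[ℝ] C(I, ℝ) :=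
  ContinuousMap.compRightAlgHom ℝ ℝ ⟨fun s => t * s, by fun_prop⟩

theorem dil_apply (t : I) (f : C(I, ℝ)) (s : I) : dil t f s = f (t * s) := rfl

theorem dil_avg (t : I) (f : C(I, ℝ)) : dil t (avg f) = avg (dil t f) := by
  ext s
  simp only [dil_apply, avg_apply]
  congr 1; ext r; rw [mul_left_comm]

theorem norm_dil_le (t : I) (f : C(I, ℝ)) : ‖dil t f‖ ≤ ‖f‖ := by
  rw [ContinuousMap.norm_le _ (norm_nonneg f)]
  exact fun s => f.norm_coe_le_norm _

/-- The inclusion `[0,1] → ℝ` as an element of `C([0,1], ℝ)`. -/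
def incl : C(I, ℝ) := ⟨fun t => t, by fun_prop⟩

theorem incl_one : incl 1 = 1 := rfl

theorem dil_incl (t : I) : dil t incl = (t : ℝ) • incl := by
  ext s; rfl

/-- A dilation-covariant family averages to a primitive of its values at the right endpoint. -/
theorem hasDerivAt_mul_avg {V : ℝ → C(I, ℝ)} {η : ℝ}
    (hV : ∀ x, |x| < η → ∀ t : I, dil t (V x) = V (x * t))
    (hc : ContinuousOn (fun x => V x 1) (Ioo (-η) η)) {x : ℝ} (hx : |x| < η) :
    HasDerivAt (fun y => y * avg (V y) 1) (V x 1) x := by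
  have hη : 0 < η := (abs_nonneg x).trans_lt hx
  have hint : ∀ y, |y| < η → y * avg (V y) 1 = ∫ z in (0 : ℝ)..y, V z 1 := by
    intro y hy
    have h1 : avg (V y) 1 = ∫ s in (0 : ℝ)..1, V (y * s) 1 := by
      rw [avg_apply, intervalIntegral.integral_of_le zero_le_one, ← integral_Icc_eq_integral_Ioc,
        ← integral_subtype measurableSet_Icc (fun s : ℝ => V (y * s) 1)]
      refine integral_congr_ae (ae_of_all _ fun s => ?_)
      simp only [mul_one]
      rw [← hV y hy s, dil_apply, mul_one]
    rw [h1]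
    have := intervalIntegral.mul_integral_comp_mul_left (a := 0) (b := 1)
      (f := fun z => V z 1) y
    simpa using this
  have hmem : Ioo (-η) η ∈ 𝓝 x := Ioo_mem_nhds (abs_lt.1 hx).1 (abs_lt.1 hx).2
  have hd : HasDerivAt (fun y => ∫ z in (0 : ℝ)..y, V z 1) (V x 1) x := by
    refine intervalIntegral.integral_hasDerivAt_right ?_ ?_ (hc.continuousAt hmem)
    · refine (hc.mono fun z hz => ?_).intervalIntegrable
      exact (convex_Ioo (-η) η).ordConnected.uIcc_subset ⟨by linarith, hη⟩ (abs_lt.1 hx) hz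
    · exact hc.stronglyMeasurableAtFilter isOpen_Ioo x (abs_lt.1 hx)
  refine hd.congr_of_eventuallyEq ?_
  filter_upwards [hmem] with y hy using hint y (abs_lt.2 hy)

end Averaging

theorem AnalyticAt.isBigO_sub_sq {f : ℝ → ℝ} {a d : ℝ} (hf : AnalyticAt ℝ f a)
    (hd : HasDerivAt f d a) :
    (fun x => f x - (f a + d * (x - a))) =O[𝓝 a] fun x => (x - a) ^ 2 := by
  obtain ⟨p, hp⟩ := hf
  have h := hp.isBigO_sub_partialSum_pow 2
  have ht : Tendsto (fun x : ℝ => x - a) (𝓝 a) (𝓝 0) := by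
    have : ContinuousAt (fun x : ℝ => x - a) a := by fun_prop
    simpa [ContinuousAt] using this
  have h2 := h.comp_tendsto ht
  have hd1 : p 1 (fun _ => 1) = d := hp.hasDerivAt.unique hd
  have hd0 : p.coeff 0 = f a := hp.coeff_zero _
  refine (h2.congr (fun x => ?_) fun x => ?_)
  · have hc1 : p.coeff 1 = d := by rw [← hd1]; rfl
    simp [FormalMultilinearSeries.partialSum, Finset.sum_range_succ, hd0, hc1, mul_comm]
  · simp

section Desingularized

open scoped unitInterval ContDiff

/-- The state space for the unknowns `(H', cos 2H, 1/A, 1/ρ, (Z-1)/(ρ-1), (ρ-1)/(Z²-1))`. -/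
abbrev CSSState : Type :=
  C(I, ℝ) × C(I, ℝ) × C(I, ℝ) × C(I, ℝ) × C(I, ℝ) × C(I, ℝ)

namespace CSSState

/-- Componentwise dilation. -/
def dilate (t : I) (u : CSSState) : CSSState :=
  (dil t u.1, dil t u.2.1, dil t u.2.2.1, dil t u.2.2.2.1, dil t u.2.2.2.2.1, dil t u.2.2.2.2.2)

theorem norm_dilate_le (t : I) (u : CSSState) : ‖dilate t u‖ ≤ ‖u‖ := by
  obtain ⟨p, c, q, w, z, y⟩ := u
  simp only [dilate, Prod.norm_def]
  gcongr <;> exact norm_dil_le _ _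

theorem dilate_sub (t : I) (u v : CSSState) : dilate t (u - v) = dilate t u - dilate t v := by
  simp [dilate]

theorem dilate_add (t : I) (u v : CSSState) : dilate t (u + v) = dilate t u + dilate t v := by
  simp [dilate]

theorem dilate_smul (t : I) (r : ℝ) (u : CSSState) : dilate t (r • u) = r • dilate t u := by
  simp [dilate]

/-- The quotient `sin (2H) / (ρ - 1)`. -/
def sinQuot (u : CSSState) : C(I, ℝ) := avg ((2 : ℝ) • (u.2.1 * u.1))

/-- The right-hand side of the equation for `H''`. -/
def rhsH (α r : ℝ) (u : CSSState) : C(I, ℝ) :=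
  -(2 : ℝ) • (u.2.2.2.1 * u.1)
    + α • ((1 + (1 + r • (incl * u.2.2.2.2.1)) ^ 2) * (1 + r • incl) * u.1 ^ 3)
    + sinQuot u * u.2.2.2.2.2 * u.2.2.1 * u.2.2.2.1 ^ 2

/-- The right-hand side of the equation for `(cos 2H)'`. -/
def rhsCos (r : ℝ) (u : CSSState) : C(I, ℝ) :=
  -(2 : ℝ) • (r • (incl * sinQuot u) * u.1)

/-- The right-hand side of the equation for `(1/A)'`. -/
def rhsInvA (α r : ℝ) (u : CSSState) : C(I, ℝ) :=
  (2 * α) • ((1 + r • incl) * u.1 ^ 2 * u.2.2.1)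

/-- The quotient `(Z' - 1) / (ρ - 1)`, up to the dilation parameter. -/
def rhsZ (α r : ℝ) (u : CSSState) : C(I, ℝ) :=
  incl * (u.2.2.2.1 * (u.2.2.2.2.1 - 1)
    - α • ((1 + r • (incl * u.2.2.2.2.1)) * (1 + r • incl) * u.2.2.2.2.1
      * (1 + (1 + r • (incl * u.2.2.2.2.1))) * u.1 ^ 2))

/-- The deviation of `((Z - 1) / (ρ - 1)) (1 + Z)` from `2`, up to the dilation parameter. -/
def devZ (α r : ℝ) (u : CSSState) : C(I, ℝ) :=
  (2 : ℝ) • avg (rhsZ α r u) + incl * u.2.2.2.2.1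
    + r • (incl * u.2.2.2.2.1) * avg (rhsZ α r u)

/-- The nonlinearity of the desingularized CSS system. -/
def rhs (α : ℝ) (v : ℝ × CSSState) : CSSState :=
  (incl * avg (rhsH α v.1 v.2), incl * avg (rhsCos v.1 v.2), incl * avg (rhsInvA α v.1 v.2),
    -(incl * v.2.2.2.2.1), avg (rhsZ α v.1 v.2),
    -(1 / 2 : ℝ) • (v.2.2.2.2.2.2 * devZ α v.1 v.2))

/-- The data at the horizon. -/
def init (α b : ℝ) : CSSState :=
  (b • 1, 1, (1 / (1 - 2 * α)) • 1, 1, 1, (1 / 2 : ℝ) • 1)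

theorem dilate_init (t : I) (α b : ℝ) : dilate t (init α b) = init α b := by
  simp [dilate, init]

theorem contDiff_init (α : ℝ) : ContDiff ℝ ω (init α) := by
  unfold init; fun_prop

theorem contDiff_sinQuot : ContDiff ℝ ω sinQuot := by
  unfold sinQuot; fun_prop

theorem contDiff_rhsH (α : ℝ) : ContDiff ℝ ω fun v : ℝ × CSSState => rhsH α v.1 v.2 := by
  have := contDiff_sinQuot
  unfold rhsH; fun_prop

theorem contDiff_rhsCos : ContDiff ℝ ω fun v : ℝ × CSSState => rhsCos v.1 v.2 := by
  have := contDiff_sinQuot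
  unfold rhsCos; fun_prop

theorem contDiff_rhsInvA (α : ℝ) : ContDiff ℝ ω fun v : ℝ × CSSState => rhsInvA α v.1 v.2 := by
  unfold rhsInvA; fun_prop

theorem contDiff_rhsZ (α : ℝ) : ContDiff ℝ ω fun v : ℝ × CSSState => rhsZ α v.1 v.2 := by
  unfold rhsZ; fun_prop

theorem contDiff_rhs (α : ℝ) : ContDiff ℝ ω (rhs α) := by
  have h1 := contDiff_rhsH α
  have h2 := contDiff_rhsCos
  have h3 := contDiff_rhsInvA α
  have h4 := contDiff_rhsZ α
  unfold rhs devZ; fun_prop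

theorem dil_sinQuot (t : I) (u : CSSState) : dil t (sinQuot u) = sinQuot (dilate t u) := by
  simp [sinQuot, dilate, dil_avg]

theorem dil_rhsH (t : I) (α r : ℝ) (u : CSSState) :
    dil t (rhsH α r u) = rhsH α (r * t) (dilate t u) := by
  simp [rhsH, dil_sinQuot, dil_incl, mul_smul]
  simp [dilate]

theorem dil_rhsCos (t : I) (r : ℝ) (u : CSSState) :
    dil t (rhsCos r u) = rhsCos (r * t) (dilate t u) := by
  simp [rhsCos, dil_sinQuot, dil_incl, mul_smul]
  simp [dilate]

theorem dil_rhsInvA (t : I) (α r : ℝ) (u : CSSState) :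
    dil t (rhsInvA α r u) = rhsInvA α (r * t) (dilate t u) := by
  simp [rhsInvA, dil_incl, mul_smul]
  simp [dilate]

theorem dil_rhsZ (t : I) (α r : ℝ) (u : CSSState) :
    dil t (rhsZ α r u) = (t : ℝ) • rhsZ α (r * t) (dilate t u) := by
  simp [rhsZ, dil_incl, mul_smul]
  simp [dilate]

theorem dil_devZ (t : I) (α r : ℝ) (u : CSSState) :
    dil t (devZ α r u) = (t : ℝ) • devZ α (r * t) (dilate t u) := by
  simp only [devZ, map_add, map_smul, map_mul, dil_avg, dil_rhsZ, dil_incl]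
  simp only [dilate]
  ext s
  simp
  ring

theorem dilate_rhs (t : I) (α r : ℝ) (u : CSSState) :
    dilate t (rhs α (r, u)) = (t : ℝ) • rhs α (r * t, dilate t u) := by
  rw [dilate]
  simp only [rhs, dil_avg, dil_incl, dil_rhsZ, dil_devZ, dil_rhsH, dil_rhsCos, dil_rhsInvA,
    map_mul, map_neg, map_smul]
  simp [dilate]
  rw [smul_comm]

/-- The desingularized CSS system has a family of solutions covariant under dilations. -/
theorem exists_covariant_solution (α : ℝ) :
    ∃ (Ψ : ℝ × ℝ → CSSState) (η : ℝ → ℝ), ∀ b : ℝ, 0 < η b ∧ ∀ x : ℝ, |x| < η b →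
      AnalyticAt ℝ Ψ (b, x) ∧ ‖Ψ (b, x) - init α b‖ < 1 ∧
      Ψ (b, x) = init α b + x • rhs α (x, Ψ (b, x)) ∧
      ∀ t : I, dilate t (Ψ (b, x)) = Ψ (b, x * t) := by
  obtain ⟨Ψ, η, δ, h⟩ := exists_glued_solution (contDiff_rhs α) (contDiff_init α)
  refine ⟨Ψ, η, fun b => ⟨(h b).1, fun x hx => ?_⟩⟩
  obtain ⟨h1, h2, h3, -⟩ := (h b).2.2 x hx
  refine ⟨h1, h2.trans_le (h b).2.1, h3, fun t => ?_⟩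
  have hxt : |x * t| < η b := by
    rw [abs_mul, abs_of_nonneg t.2.1]
    exact (mul_le_of_le_one_right (abs_nonneg x) t.2.2).trans_lt hx
  refine (((h b).2.2 _ hxt).2.2.2 _ ?_ ?_).symm
  · have := norm_dilate_le t (Ψ (b, x) - init α b)
    rw [dilate_sub, dilate_init] at this
    exact this.trans_lt h2
  · conv_lhs => rw [h3]
    rw [dilate_add, dilate_smul, dilate_init, dilate_rhs, smul_smul]

theorem hasDerivAt_of_covariant {u : ℝ → CSSState} {η : ℝ} {F : ℝ × CSSState → C(I, ℝ)}
    (hF : Continuous F) (hFd : ∀ t : I, ∀ r v, dil t (F (r, v)) = F (r * t, dilate t v))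
    (hu : ContinuousOn u (Ioo (-η) η)) (hd : ∀ x, |x| < η → ∀ t : I, dilate t (u x) = u (x * t))
    {x : ℝ} (hx : |x| < η) :
    HasDerivAt (fun y => y * avg (F (y, u y)) 1) (F (x, u x) 1) x := by
  refine hasDerivAt_mul_avg (V := fun y => F (y, u y)) (η := η)
    (fun y hy t => by rw [hFd, hd y hy]) ?_ hx
  have : Continuous fun f : C(I, ℝ) => f 1 := by fun_prop
  exact this.comp_continuousOn (hF.comp_continuousOn (continuousOn_id.prodMk hu))

end CSSState

open CSSState in
/-- Scalar form of the desingularized CSS system in the variable `x = ρ - 1`; here `g` is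
`H / x`, `k` is `sin (2H) / x` and `p, c, q, w, z` are `H', cos (2H), 1/A, 1/ρ, (Z - 1)/x`. -/
theorem exists_desingularized_solution (α : ℝ) :
    ∃ (g p c q w z y k : ℝ × ℝ → ℝ) (η : ℝ → ℝ), ∀ b : ℝ, 0 < η b ∧
      (p (b, 0) = b ∧ c (b, 0) = 1 ∧ q (b, 0) = 1 / (1 - 2 * α) ∧ z (b, 0) = 1) ∧
      ∀ x : ℝ, |x| < η b →
        AnalyticAt ℝ g (b, x) ∧ AnalyticAt ℝ q (b, x) ∧ AnalyticAt ℝ z (b, x) ∧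
        |q (b, x) - 1 / (1 - 2 * α)| < 1 ∧
        w (b, x) * (1 + x) = 1 ∧ y (b, x) * (z (b, x) * (2 + x * z (b, x))) = 1 ∧
        HasDerivAt (fun x => x * g (b, x)) (p (b, x)) x ∧
        HasDerivAt (fun x => x * k (b, x)) (2 * (c (b, x) * p (b, x))) x ∧
        HasDerivAt (fun x => p (b, x))
          (-2 * (w (b, x) * p (b, x))
            + α * ((1 + (1 + x * z (b, x)) ^ 2) * (1 + x) * p (b, x) ^ 3)
            + k (b, x) * y (b, x) * q (b, x) * w (b, x) ^ 2) x ∧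
        HasDerivAt (fun x => c (b, x)) (-2 * (x * k (b, x) * p (b, x))) x ∧
        HasDerivAt (fun x => q (b, x)) (2 * α * ((1 + x) * p (b, x) ^ 2 * q (b, x))) x ∧
        HasDerivAt (fun x => x * z (b, x))
          (1 + x * (w (b, x) * (z (b, x) - 1) - α * ((1 + x * z (b, x)) * (1 + x) * z (b, x)
            * (2 + x * z (b, x)) * p (b, x) ^ 2))) x := by
  obtain ⟨Ψ, η, h⟩ := exists_covariant_solution α
  refine ⟨fun v => avg (Ψ v).1 1, fun v => (Ψ v).1 1, fun v => (Ψ v).2.1 1,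
    fun v => (Ψ v).2.2.1 1, fun v => (Ψ v).2.2.2.1 1, fun v => (Ψ v).2.2.2.2.1 1,
    fun v => (Ψ v).2.2.2.2.2 1, fun v => sinQuot (Ψ v) 1, η, fun b => ?_⟩
  obtain ⟨hη, h⟩ := h b
  have han := fun x hx => (h x hx).1
  have hball := fun x hx => (h x hx).2.1
  have heq := fun x hx => (h x hx).2.2.1
  have hdil := fun x hx => (h x hx).2.2.2
  have hcont : ContinuousOn (fun x => Ψ (b, x)) (Ioo (-η b) (η b)) := fun x hx =>
    ((han x (abs_lt.2 hx)).continuousAt.comp' (by fun_prop : ContinuousAt (fun x => (b, x)) x)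
      ).continuousWithinAt
  have ep : ∀ x, |x| < η b →
      (Ψ (b, x)).1 1 = b + x * avg (rhsH α x (Ψ (b, x))) 1 := fun x hx => by
    have := congrArg (fun v : CSSState => v.1 1) (heq x hx)
    simpa [rhs, init, incl_one] using this
  have ec : ∀ x, |x| < η b →
      (Ψ (b, x)).2.1 1 = 1 + x * avg (rhsCos x (Ψ (b, x))) 1 := fun x hx => by
    have := congrArg (fun v : CSSState => v.2.1 1) (heq x hx)
    simpa [rhs, init, incl_one] using this
  have eq₀ : ∀ x, |x| < η b →
      (Ψ (b, x)).2.2.1 1 = 1 / (1 - 2 * α) + x * avg (rhsInvA α x (Ψ (b, x))) 1 := fun x hx => by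
    have := congrArg (fun v : CSSState => v.2.2.1 1) (heq x hx)
    simpa [rhs, init, incl_one] using this
  have ew : ∀ x, |x| < η b →
      (Ψ (b, x)).2.2.2.1 1 = 1 - x * (Ψ (b, x)).2.2.2.1 1 := fun x hx => by
    have := congrArg (fun v : CSSState => v.2.2.2.1 1) (heq x hx)
    simpa [rhs, init, incl_one, sub_eq_add_neg] using this
  have ez : ∀ x, |x| < η b →
      (Ψ (b, x)).2.2.2.2.1 = 1 + x • avg (rhsZ α x (Ψ (b, x))) := fun x hx => by
    have := congrArg (fun v : CSSState => v.2.2.2.2.1) (heq x hx)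
    simpa [rhs, init, incl_one] using this
  have ey : ∀ x, |x| < η b → (Ψ (b, x)).2.2.2.2.2 1
      = 1 / 2 - 1 / 2 * x * ((Ψ (b, x)).2.2.2.2.2 1 * devZ α x (Ψ (b, x)) 1) := fun x hx => by
    have := congrArg (fun v : CSSState => v.2.2.2.2.2 1) (heq x hx)
    simp [rhs, init] at this
    linarith
  have hev : ∀ {f : C(I, ℝ)}, AnalyticAt ℝ (fun f : C(I, ℝ) => f 1) f := fun {f} =>
    (ContinuousMap.evalCLM ℝ (1 : I)).analyticAt f
  have h0 : |(0 : ℝ)| < η b := by simpa using hη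
  have hnear : ∀ x, |x| < η b → ∀ᶠ y in 𝓝 x, |y| < η b := fun x hx =>
    (continuous_abs.tendsto x).eventually_lt_const hx
  have hder : ∀ {F : ℝ × CSSState → C(I, ℝ)}, Continuous F →
      (∀ t : I, ∀ r v, dil t (F (r, v)) = F (r * t, dilate t v)) → ∀ x, |x| < η b →
      HasDerivAt (fun y => y * avg (F (y, Ψ (b, y))) 1) (F (x, Ψ (b, x)) 1) x :=
    fun hF hFd x hx => hasDerivAt_of_covariant hF hFd hcont hdil hx
  refine ⟨hη, ⟨?_, ?_, ?_, ?_⟩, fun x hx => ⟨?_, ?_, ?_, ?_, ?_, ?_, ?_, ?_, ?_, ?_, ?_, ?_⟩⟩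
  · simpa using ep 0 h0
  · simpa using ec 0 h0
  · simpa using eq₀ 0 h0
  · simp [ez 0 h0]
  · exact (hev.comp (avg.analyticAt _)).comp (analyticAt_fst.comp (han x hx))
  · exact hev.comp (analyticAt_fst.comp
      (analyticAt_snd.comp (analyticAt_snd.comp (han x hx))))
  · exact hev.comp (analyticAt_fst.comp (analyticAt_snd.comp (analyticAt_snd.comp
      (analyticAt_snd.comp (analyticAt_snd.comp (han x hx))))))
  · have h1 := norm_fst_le (Ψ (b, x) - init α b).2.2
    have h2 := norm_snd_le (Ψ (b, x) - init α b).2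
    have h3 := norm_snd_le (Ψ (b, x) - init α b)
    have h4 := (Ψ (b, x) - init α b).2.2.1.norm_coe_le_norm 1
    have h5 := (h4.trans (h1.trans (h2.trans h3))).trans_lt (hball x hx)
    simpa [init] using h5
  · linarith [ew x hx]
  · have h1 := ey x hx
    have h2 : (Ψ (b, x)).2.2.2.2.1 1 = 1 + x * avg (rhsZ α x (Ψ (b, x))) 1 := by
      simpa using congrArg (fun f : C(I, ℝ) => f 1) (ez x hx)
    have h3 : devZ α x (Ψ (b, x)) 1 = 2 * avg (rhsZ α x (Ψ (b, x))) 1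
        + (Ψ (b, x)).2.2.2.2.1 1
        + x * (Ψ (b, x)).2.2.2.2.1 1 * avg (rhsZ α x (Ψ (b, x))) 1 := by
      simp [devZ, incl_one, mul_assoc]
    have h4 : (Ψ (b, x)).2.2.2.2.1 1 * (2 + x * (Ψ (b, x)).2.2.2.2.1 1)
        = 2 + x * devZ α x (Ψ (b, x)) 1 := by
      rw [h3]
      linear_combination (2 + x * (Ψ (b, x)).2.2.2.2.1 1) * h2
    rw [h4]
    linear_combination 2 * h1
  · exact hder (F := fun v => v.2.1) (by fun_prop) (fun t r v => rfl) x hx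
  · have := hder (F := fun v => (2 : ℝ) • (v.2.2.1 * v.2.1)) (by fun_prop)
      (fun t r v => by simp [dilate]) x hx
    simpa [sinQuot] using this
  · have := (hder (contDiff_rhsH α).continuous (fun t r v => dil_rhsH t α r v) x hx).const_add b
    have h2 := this.congr_of_eventuallyEq ((hnear x hx).mono fun y hy => ep y hy)
    simpa [rhsH, incl_one] using h2
  · have := (hder contDiff_rhsCos.continuous (fun t r v => dil_rhsCos t r v) x hx).const_add 1
    have h2 := this.congr_of_eventuallyEq ((hnear x hx).mono fun y hy => ec y hy)
    simpa [rhsCos, incl_one, mul_assoc] using h2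
  · have := (hder (contDiff_rhsInvA α).continuous (fun t r v => dil_rhsInvA t α r v)
      x hx).const_add (1 / (1 - 2 * α))
    have h2 := this.congr_of_eventuallyEq ((hnear x hx).mono fun y hy => eq₀ y hy)
    simpa [rhsInvA, incl_one] using h2
  · have := hder (F := fun v => 1 + v.1 • rhsZ α v.1 v.2)
      (by have := (contDiff_rhsZ α).continuous; fun_prop)
      (fun t r v => by simp [dil_rhsZ, mul_smul]) x hx
    have h2 := this.congr_of_eventuallyEq (f₁ := fun x => x * (Ψ (b, x)).2.2.2.2.1 1)
      ((hnear x hx).mono fun y hy => by simp [ez y hy, avg_one])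
    refine h2.congr_deriv ?_
    simp [rhsZ, incl_one, -mul_eq_mul_left_iff]
    ring

end Desingularized

/-- The linear system `s' = 2 p c`, `c' = -2 p s` is solved by the sine and cosine of a
primitive of `2 p`. -/
theorem eq_sin_of_hasDerivAt {h p c s : ℝ → ℝ} {η : ℝ} (h0 : h 0 = 0) (s0 : s 0 = 0)
    (c0 : c 0 = 1) (hh : ∀ x, |x| < η → HasDerivAt h (p x) x)
    (hs : ∀ x, |x| < η → HasDerivAt s (2 * (c x * p x)) x)
    (hc : ∀ x, |x| < η → HasDerivAt c (-2 * (s x * p x)) x) {x : ℝ} (hx : |x| < η) :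
    Real.sin (2 * h x) = s x := by
  set φ : ℝ → ℝ := fun x => (s x - Real.sin (2 * h x)) ^ 2 + (c x - Real.cos (2 * h x)) ^ 2
    with hφ
  have hd : ∀ x, |x| < η → HasDerivAt φ 0 x := by
    intro x hx
    have hh2 := (hh x hx).const_mul 2
    refine ((((hs x hx).sub hh2.sin).pow 2).add (((hc x hx).sub hh2.cos).pow 2)).congr_deriv ?_
    simp
    ring
  have hη : 0 < η := (abs_nonneg x).trans_lt hx
  have hφx : φ x = φ 0 := by
    refine isOpen_Ioo.is_const_of_deriv_eq_zero (s := Ioo (-η) η) isPreconnected_Ioo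
      (fun y hy => (hd y (abs_lt.2 hy)).differentiableAt.differentiableWithinAt)
      (fun y hy => (hd y (abs_lt.2 hy)).deriv) (abs_lt.1 hx) ⟨by linarith, hη⟩
  have hφ0 : φ 0 = 0 := by simp [hφ, h0, s0, c0]
  rw [hφ0] at hφx
  simp only [hφ] at hφx
  nlinarith [sq_nonneg (s x - Real.sin (2 * h x)), sq_nonneg (c x - Real.cos (2 * h x))]

/-- Proposition 15: local existence of a one-parameter family of solutions of
the CSS system near the singular point `ρ = 1` (the past self-similarity
horizon), real-analytic in `ρ` and depending analytically on the parameter `b`,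
with the expansions `H = b(ρ-1) + O((ρ-1)²)`,
`A = 1 - 2α - 2α(1-2α)b²(ρ-1) + O((ρ-1)²)`, `Z = ρ + O((ρ-1)²)`. -/
theorem proposition15 (α : ℝ) (hα0 : 0 < α) (hα : α < 1 / 2) :
    ∃ (H A Z : ℝ → ℝ → ℝ) (ε : ℝ → ℝ),
      ∀ b : ℝ,
        0 < ε b ∧
        (∀ ρ ∈ Set.Ioo (1 - ε b) (1 + ε b), ρ ≠ 1 →
          deriv (deriv (H b)) ρ + (2 / ρ) * deriv (H b) ρ
              - α * (1 + Z b ρ ^ 2) * ρ * deriv (H b) ρ ^ 3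
              + Real.sin (2 * H b ρ)
                  / (A b ρ * ρ ^ 2 * (1 - Z b ρ ^ 2)) = 0 ∧
          deriv (A b) ρ = -2 * α * ρ * A b ρ * deriv (H b) ρ ^ 2 ∧
          ρ * deriv (Z b) ρ
              = Z b ρ * (1 + α * (1 - Z b ρ ^ 2) * ρ ^ 2
                  * deriv (H b) ρ ^ 2)) ∧
        (∀ ρ ∈ Set.Ioo (1 - ε b) (1 + ε b),
          AnalyticAt ℝ (fun p : ℝ × ℝ => H p.1 p.2) (b, ρ) ∧
          AnalyticAt ℝ (fun p : ℝ × ℝ => A p.1 p.2) (b, ρ) ∧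
          AnalyticAt ℝ (fun p : ℝ × ℝ => Z p.1 p.2) (b, ρ)) ∧
        (fun ρ => H b ρ - b * (ρ - 1)) =O[𝓝 1] (fun ρ => (ρ - 1) ^ 2) ∧
        (fun ρ => A b ρ - (1 - 2 * α - 2 * α * (1 - 2 * α) * b ^ 2 * (ρ - 1)))
            =O[𝓝 1] (fun ρ => (ρ - 1) ^ 2) ∧
        (fun ρ => Z b ρ - ρ) =O[𝓝 1] (fun ρ => (ρ - 1) ^ 2) := by
  obtain ⟨g, p, c, q, w, z, y, k, η, h⟩ := exists_desingularized_solution α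
  refine ⟨fun b ρ => (ρ - 1) * g (b, ρ - 1), fun b ρ => (q (b, ρ - 1))⁻¹,
    fun b ρ => 1 + (ρ - 1) * z (b, ρ - 1), η, fun b => ?_⟩
  obtain ⟨hη, ⟨p0, c0, q0, z0⟩, h⟩ := h b
  choose hg hqa hza hqn hw hy dH ds dp dc dq dz using h
  have h0 : |(0 : ℝ)| < η b := by simpa using hη
  have hα1 : 0 < 1 - 2 * α := by linarith
  have hq : ∀ x, |x| < η b → q (b, x) ≠ 0 := fun x hx => by
    have h1 := (abs_lt.1 (hqn x hx)).1
    have h2 : 1 ≤ 1 / (1 - 2 * α) := by rw [le_div_iff₀ hα1]; linarith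
    exact (by linarith : 0 < q (b, x)).ne'
  have hsin : ∀ x, |x| < η b → Real.sin (2 * (x * g (b, x))) = x * k (b, x) := fun x hx =>
    eq_sin_of_hasDerivAt (h := fun x => x * g (b, x)) (s := fun x => x * k (b, x))
      (by simp) (by simp) c0 dH ds dc hx
  have hshift : ∀ ρ, ρ ∈ Ioo (1 - η b) (1 + η b) → |ρ - 1| < η b := fun ρ hρ =>
    abs_lt.2 ⟨by linarith [hρ.1], by linarith [hρ.2]⟩
  have hH : ∀ ρ ∈ Ioo (1 - η b) (1 + η b),
      HasDerivAt (fun ρ => (ρ - 1) * g (b, ρ - 1)) (p (b, ρ - 1)) ρ := fun ρ hρ =>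
    (dH _ (hshift ρ hρ)).comp_sub_const ρ 1
  have hA : ∀ ρ ∈ Ioo (1 - η b) (1 + η b), HasDerivAt (fun ρ => (q (b, ρ - 1))⁻¹)
      (-2 * α * ρ * (q (b, ρ - 1))⁻¹ * p (b, ρ - 1) ^ 2) ρ := fun ρ hρ => by
    have hq1 := hq _ (hshift ρ hρ)
    refine (((dq _ (hshift ρ hρ)).comp_sub_const ρ 1).fun_inv hq1).congr_deriv ?_
    field_simp
    ring
  have hZ := fun ρ (hρ : ρ ∈ Ioo (1 - η b) (1 + η b)) =>
    ((dz _ (hshift ρ hρ)).comp_sub_const ρ 1).const_add 1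
  have hHan : ∀ ρ ∈ Ioo (1 - η b) (1 + η b),
      AnalyticAt ℝ (fun p : ℝ × ℝ => (p.2 - 1) * g (p.1, p.2 - 1)) (b, ρ) ∧
      AnalyticAt ℝ (fun p : ℝ × ℝ => (q (p.1, p.2 - 1))⁻¹) (b, ρ) ∧
      AnalyticAt ℝ (fun p : ℝ × ℝ => 1 + (p.2 - 1) * z (p.1, p.2 - 1)) (b, ρ) := by
    intro ρ hρ
    have hx := hshift ρ hρ
    have hs2 : AnalyticAt ℝ (fun p : ℝ × ℝ => p.2 - 1) (b, ρ) :=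
      analyticAt_snd.sub analyticAt_const
    have hs : AnalyticAt ℝ (fun p : ℝ × ℝ => (p.1, p.2 - 1)) (b, ρ) := analyticAt_fst.prod hs2
    have hcomp : ∀ {f : ℝ × ℝ → ℝ}, AnalyticAt ℝ f (b, ρ - 1) →
        AnalyticAt ℝ (fun p : ℝ × ℝ => f (p.1, p.2 - 1)) (b, ρ) := fun hf =>
      AnalyticAt.fun_comp (f := fun p : ℝ × ℝ => (p.1, p.2 - 1)) hf hs
    exact ⟨hs2.mul (hcomp (hg _ hx)), (hcomp (hqa _ hx)).fun_inv (hq _ hx),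
      analyticAt_const.add (hs2.mul (hcomp (hza _ hx)))⟩
  have h1mem : (1 : ℝ) ∈ Ioo (1 - η b) (1 + η b) := ⟨by linarith, by linarith⟩
  have hline : AnalyticAt ℝ (fun ρ : ℝ => (b, ρ)) 1 := by fun_prop
  refine ⟨hη, fun ρ hρ hρ1 => ⟨?_, ?_, ?_⟩, hHan, ?_, ?_, ?_⟩
  · have hx := hshift ρ hρ
    have hdd : deriv (deriv fun ρ => (ρ - 1) * g (b, ρ - 1)) ρ = _ :=
      (((dp _ hx).comp_sub_const ρ 1).congr_of_eventuallyEq (by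
        filter_upwards [Ioo_mem_nhds hρ.1 hρ.2] with r hr using (hH r hr).deriv)).deriv
    rw [hdd, (hH ρ hρ).deriv, hsin _ hx]
    have hw1 := hw _ hx
    have hy1 := hy _ hx
    have hq1 := hq _ hx
    have hx0 : ρ - 1 ≠ 0 := sub_ne_zero.2 hρ1
    rw [add_sub_cancel] at hw1 ⊢
    have hρ0 : ρ ≠ 0 := right_ne_zero_of_mul_eq_one hw1
    have hzz : z (b, ρ - 1) * (2 + (ρ - 1) * z (b, ρ - 1)) ≠ 0 :=
      right_ne_zero_of_mul_eq_one hy1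
    have hfac : (q (b, ρ - 1))⁻¹ * ρ ^ 2 * (1 - (1 + (ρ - 1) * z (b, ρ - 1)) ^ 2)
        = -((q (b, ρ - 1))⁻¹ * ρ ^ 2 * (ρ - 1)
          * (z (b, ρ - 1) * (2 + (ρ - 1) * z (b, ρ - 1)))) := by ring
    rw [hfac, eq_div_of_mul_eq hρ0 hw1, eq_div_of_mul_eq hzz hy1]
    field_simp
    ring
  · simpa only [(hH ρ hρ).deriv] using (hA ρ hρ).deriv
  · have hx := hshift ρ hρ
    rw [(hH ρ hρ).deriv, (hZ ρ hρ).deriv]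
    have hw1 := hw _ hx
    rw [add_sub_cancel] at hw1 ⊢
    linear_combination (ρ - 1) * (z (b, ρ - 1) - 1) * hw1
  · have := AnalyticAt.isBigO_sub_sq ((hHan 1 h1mem).1.fun_comp hline) (hH 1 h1mem)
    simpa [p0] using this
  · have := AnalyticAt.isBigO_sub_sq ((hHan 1 h1mem).2.1.fun_comp hline) (hA 1 h1mem)
    refine this.congr_left fun ρ => ?_
    simp [p0, q0]
    ring
  · have := AnalyticAt.isBigO_sub_sq ((hHan 1 h1mem).2.2.fun_comp hline) (hZ 1 h1mem)
    refine this.congr_left fun ρ => ?_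
    simp
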